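/- 𝒞_2(5,4,2) = 0 and 𝒞_2(5,4,3) = 0; that is, there is no nonempty cyclic code in G_2(5,2), and none in G_2(5,3), with minimum subspace distance at least 4. -/

import Mathlib

open Module

/-- The cyclic shift `αV = {αv : v ∈ V}` of an `Fq`-subspace `V` of the extension field `F`
by a field element `α`. -/
def cyclicShift (Fq F : Type*) [Field Fq] [Field F] [Algebra Fq F]
    (α : F) (V : Submodule Fq F) : Submodule Fq F :=
  Submodule.map (LinearMap.mulLeft Fq α) V

/-- The subspace distance `d(U,W) = dim U + dim W − 2 dim (U ∩ W)`. -/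
noncomputable def subspaceDist (Fq F : Type*) [Field Fq] [Field F] [Algebra Fq F]
    (U W : Submodule Fq F) : ℕ :=
  finrank Fq U + finrank Fq W - 2 * finrank Fq ↥(U ⊓ W)

/-- `C` is a cyclic code in the Grassmannian `G_q(n,k)` (all members have dimension `k`,
and `C` is closed under cyclic shifts by nonzero field elements) with minimum subspace
distance at least `d`. -/
def IsCyclicCode (Fq F : Type*) [Field Fq] [Field F] [Algebra Fq F]
    (k d : ℕ) (C : Set (Submodule Fq F)) : Prop :=
  (∀ U ∈ C, finrank Fq U = k) ∧
  (∀ α : F, α ≠ 0 → ∀ U ∈ C, cyclicShift Fq F α U ∈ C) ∧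
  (∀ U ∈ C, ∀ W ∈ C, U ≠ W → d ≤ subspaceDist Fq F U W)

/-- The orbit `orb(V) = {αV : α ∈ F, α ≠ 0}` of a subspace `V`. -/
def orbitOf (Fq F : Type*) [Field Fq] [Field F] [Algebra Fq F]
    (V : Submodule Fq F) : Set (Submodule Fq F) :=
  {W | ∃ α : F, α ≠ 0 ∧ W = cyclicShift Fq F α V}

/-- The set of orbits of members of a code `C`. -/
def orbitsOf (Fq F : Type*) [Field Fq] [Field F] [Algebra Fq F]
    (C : Set (Submodule Fq F)) : Set (Set (Submodule Fq F)) :=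
  {O | ∃ V ∈ C, O = orbitOf Fq F V}

theorem mem_cyclicShift_of_eq_mul {Fq F : Type*} [Field Fq] [Field F] [Algebra Fq F]
    {α a b : F} {U : Submodule Fq F} (hb : b ∈ U) (h : α * b = a) :
    a ∈ cyclicShift Fq F α U :=
  ⟨b, hb, h⟩

theorem finrank_cyclicShift {Fq F : Type*} [Field Fq] [Field F] [Algebra Fq F]
    {α : F} (hα : α ≠ 0) (U : Submodule Fq F) :
    finrank Fq (cyclicShift Fq F α U) = finrank Fq U :=
  (Submodule.equivMapOfInjective (LinearMap.mulLeft Fq α)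
    (mul_right_injective₀ hα) U).finrank_eq.symm

/-- In an extension of prime degree, a nonzero subspace fixed by the cyclic shift by an element
outside the base field is the whole space. -/
theorem eq_top_of_cyclicShift_eq {Fq F : Type*} [Field Fq] [Field F] [Algebra Fq F]
    (hp : (finrank Fq F).Prime) {α : F} (hα : α ∉ (⊥ : Subalgebra Fq F))
    {U : Submodule Fq F} (hU : U ≠ ⊥) (h : cyclicShift Fq F α U = U) : U = ⊤ := by
  have := Subalgebra.isSimpleOrder_of_finrank_prime Fq F hp
  have htop : Algebra.adjoin Fq {α} = ⊤ := by
    refine (eq_bot_or_eq_top (Algebra.adjoin Fq {α})).resolve_left fun hb => hα ?_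
    exact hb ▸ Algebra.self_mem_adjoin_singleton Fq α
  have hmul : ∀ x ∈ Algebra.adjoin Fq {α}, ∀ u ∈ U, x * u ∈ U := by
    intro x hx
    induction hx using Algebra.adjoin_induction with
    | mem x hx =>
      intro u hu
      rw [Set.mem_singleton_iff.mp hx]
      exact h ▸ mem_cyclicShift_of_eq_mul hu rfl
    | algebraMap r =>
      intro u hu
      rw [← Algebra.smul_def]
      exact U.smul_mem r hu
    | add x y _ _ hx hy =>
      intro u hu
      rw [add_mul]
      exact U.add_mem (hx u hu) (hy u hu)
    | mul x y _ _ hx hy =>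
      intro u hu
      rw [mul_assoc]
      exact hx _ (hy u hu)
  obtain ⟨u, hu, hu0⟩ := U.ne_bot_iff.mp hU
  refine (Submodule.eq_top_iff').mpr fun y => ?_
  have := hmul (y / u) (htop ▸ Algebra.mem_top) u hu
  rwa [div_mul_cancel₀ _ hu0] at this

theorem notMem_bot_of_ne_zero_of_ne_one {F : Type*} [Field F] [Algebra (ZMod 2) F]
    {α : F} (h0 : α ≠ 0) (h1 : α ≠ 1) : α ∉ (⊥ : Subalgebra (ZMod 2) F) := by
  rintro h
  obtain ⟨r, rfl⟩ := Algebra.mem_bot.mp h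
  fin_cases r
  · exact h0 (map_zero _)
  · exact h1 (map_one _)

theorem card_le_two_pow_finrank {V : Type*} [AddCommGroup V] [Module (ZMod 2) V] [Finite V]
    (U : Submodule (ZMod 2) V) (s : Finset V) (hs : ∀ x ∈ s, x ∈ U) :
    s.card ≤ 2 ^ finrank (ZMod 2) U := by
  have h := Module.natCard_eq_pow_finrank (K := ZMod 2) (V := U)
  rw [Nat.card_zmod] at h
  rw [← h, ← Set.ncard_coe_finset]
  exact Set.ncard_le_ncard (t := (U : Set V)) hs (Set.toFinite _)

/-- A member of a cyclic code meets each of its shifts by `α ≠ 0, 1` in a space of small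
dimension. -/
theorem IsCyclicCode.add_two_mul_finrank_inf_le {F : Type*} [Field F] [Algebra (ZMod 2) F]
    (hp : (finrank (ZMod 2) F).Prime) {k d : ℕ} (hk0 : k ≠ 0) (hk : k ≠ finrank (ZMod 2) F)
    (hd : d ≠ 0)
    {C : Set (Submodule (ZMod 2) F)} (hC : IsCyclicCode (ZMod 2) F k d C)
    {U : Submodule (ZMod 2) F} (hU : U ∈ C) {α : F} (h0 : α ≠ 0) (h1 : α ≠ 1) :
    d + 2 * finrank (ZMod 2) ↥(U ⊓ cyclicShift (ZMod 2) F α U) ≤ 2 * k := by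
  obtain ⟨hdim, hshift, hdist⟩ := hC
  have hne : U ≠ cyclicShift (ZMod 2) F α U := by
    intro h
    have hbot : U ≠ ⊥ := by
      rintro rfl
      exact hk0 (by simpa using (hdim _ hU).symm)
    have htop := eq_top_of_cyclicShift_eq hp (notMem_bot_of_ne_zero_of_ne_one h0 h1) hbot h.symm
    rw [← hdim U hU, htop, finrank_top] at hk
    exact hk rfl
  have h := hdist U hU _ (hshift α h0 U hU) hne
  rw [subspaceDist, finrank_cyclicShift h0, hdim U hU] at h
  omega

/-- A cyclic code with constant dimension `k` is empty if there are more than `2 ^ n - 2`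
ordered pairs of distinct nonzero vectors in a `k`-dimensional space, where `2 ^ n = |F|`, and
the minimum distance exceeds `2 * k - 4`. -/
theorem IsCyclicCode.eq_empty_of_card_lt {F : Type*} [Field F] [Finite F] [Algebra (ZMod 2) F]
    (hp : (finrank (ZMod 2) F).Prime) {k d : ℕ} (hk0 : k ≠ 0) (hk : k ≠ finrank (ZMod 2) F)
    (hd : 2 * k < d + 4) (hd0 : d ≠ 0)
    (hcard : 2 ^ finrank (ZMod 2) F - 2 < (2 ^ k - 1) * (2 ^ k - 1) - (2 ^ k - 1))
    {C : Set (Submodule (ZMod 2) F)} (hC : IsCyclicCode (ZMod 2) F k d C) : C = ∅ := by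
  classical
  have := Fintype.ofFinite F
  refine Set.eq_empty_of_forall_notMem fun U hU => ?_
  let s : Finset F := (Finset.univ.filter (· ∈ U)).erase 0
  have hs : s.card = 2 ^ k - 1 := by
    have h := Module.natCard_eq_pow_finrank (K := ZMod 2) (V := U)
    rw [Nat.card_zmod, hC.1 U hU, Nat.card_eq_fintype_card, Fintype.card_subtype] at h
    rw [Finset.card_erase_of_mem (by simp), h]
  have hF : (({0, 1} : Finset F)ᶜ).card = 2 ^ finrank (ZMod 2) F - 2 := by
    have h := Module.natCard_eq_pow_finrank (K := ZMod 2) (V := F)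
    rw [Nat.card_zmod, Nat.card_eq_fintype_card] at h
    rw [Finset.card_compl, h, Finset.card_pair zero_ne_one]
  have hmaps : ∀ x ∈ s.offDiag, x.1 / x.2 ∈ (({0, 1} : Finset F)ᶜ) := by
    rintro ⟨a, b⟩ hx
    simp only [s, Finset.mem_offDiag, Finset.mem_erase] at hx
    obtain ⟨⟨ha, -⟩, ⟨hb, -⟩, hab⟩ := hx
    simp [ha, hb, hab, div_eq_one_iff_eq hb]
  obtain ⟨⟨a, b⟩, hx, ⟨a', b'⟩, hy, hxy, h⟩ := Finset.exists_ne_map_eq_of_card_lt_of_maps_to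
    (by rwa [hF, Finset.offDiag_card, hs]) hmaps
  have hα := hmaps _ hx
  simp only [s, Finset.mem_offDiag, Finset.mem_erase, Finset.mem_filter_univ] at hx hy
  obtain ⟨⟨ha, haU⟩, ⟨hb, hbU⟩, -⟩ := hx
  obtain ⟨⟨ha', haU'⟩, ⟨hb', hbU'⟩, -⟩ := hy
  dsimp only at h hα
  simp only [Finset.mem_compl, Finset.mem_insert, Finset.mem_singleton, not_or] at hα
  have haa : a ≠ a' := by
    rintro rfl
    refine hxy (Prod.ext rfl ?_)
    rw [div_eq_div_iff hb hb'] at h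
    exact (mul_left_cancel₀ ha h).symm
  have hle := hC.add_two_mul_finrank_inf_le hp hk0 hk hd0 hU hα.1 hα.2
  have hthree := card_le_two_pow_finrank (U ⊓ cyclicShift (ZMod 2) F (a / b) U) {0, a, a'} (by
    simp only [Finset.mem_insert, Finset.mem_singleton]
    rintro x (rfl | rfl | rfl)
    · exact zero_mem _
    · exact ⟨haU, mem_cyclicShift_of_eq_mul hbU (div_mul_cancel₀ _ hb)⟩
    · exact ⟨haU', mem_cyclicShift_of_eq_mul hbU' (by rw [h, div_mul_cancel₀ _ hb'])⟩)
  rw [Finset.card_eq_three.mpr ⟨0, a, a', ha.symm, ha'.symm, haa, rfl⟩] at hthree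
  have : finrank (ZMod 2) ↥(U ⊓ cyclicShift (ZMod 2) F (a / b) U) ≤ 1 := by omega
  have := Nat.pow_le_pow_right (n := 2) (by norm_num) this
  omega

/-- A binary cyclic code with constant dimension `k`, `2 ≤ k`, and minimum distance exceeding
`2 * k - 2` is empty when the extension degree is a prime other than `k`. -/
theorem IsCyclicCode.eq_empty_of_lt {F : Type*} [Field F] [Finite F] [Algebra (ZMod 2) F]
    (hp : (finrank (ZMod 2) F).Prime) {k d : ℕ} (hk2 : 2 ≤ k) (hk : k ≠ finrank (ZMod 2) F)
    (hd : 2 * k < d + 2)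
    {C : Set (Submodule (ZMod 2) F)} (hC : IsCyclicCode (ZMod 2) F k d C) : C = ∅ := by
  refine Set.eq_empty_of_forall_notMem fun U hU => ?_
  have hbot : U ≠ ⊥ := by
    rintro rfl
    have := hC.1 _ hU
    rw [finrank_bot] at this
    omega
  obtain ⟨a, haU, ha⟩ := U.ne_bot_iff.mp hbot
  obtain ⟨b, hbU, hb⟩ : ∃ b ∈ U, b ∉ Submodule.span (ZMod 2) {a} := by
    by_contra! h
    have := (Submodule.finrank_mono (show U ≤ _ from h)).trans_eq (finrank_span_singleton ha)
    rw [hC.1 U hU] at this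
    omega
  have hb0 : b ≠ 0 := fun h => hb (h ▸ zero_mem _)
  have hba : b ≠ a := by
    rintro rfl
    exact hb (Submodule.mem_span_singleton_self b)
  have hle := hC.add_two_mul_finrank_inf_le hp (by omega) hk (by omega) hU
    (div_ne_zero hb0 ha) (fun h => hba ((div_eq_one_iff_eq ha).mp h))
  have hmem : b ∈ U ⊓ cyclicShift (ZMod 2) F (b / a) U :=
    ⟨hbU, mem_cyclicShift_of_eq_mul haU (div_mul_cancel₀ _ ha)⟩
  have := Submodule.one_le_finrank_iff.mpr (Submodule.ne_bot_iff _ |>.mpr ⟨b, hmem, hb0⟩)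
  omega

/-- 𝒞_2(5,4,2) = 0 and 𝒞_2(5,4,3) = 0: every cyclic code in G_2(5,2) or
G_2(5,3) with minimum subspace distance at least 4 is empty. -/
theorem C2_5_4_eq_zero :
    (∀ C : Set (Submodule (ZMod 2) (GaloisField 2 5)),
      IsCyclicCode (ZMod 2) (GaloisField 2 5) 2 4 C → C = ∅) ∧
    (∀ C : Set (Submodule (ZMod 2) (GaloisField 2 5)),
      IsCyclicCode (ZMod 2) (GaloisField 2 5) 3 4 C → C = ∅) := by
  have hrank : finrank (ZMod 2) (GaloisField 2 5) = 5 := GaloisField.finrank 2 (by norm_num)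
  have hp : (finrank (ZMod 2) (GaloisField 2 5)).Prime := by
    rw [hrank]
    norm_num
  exact ⟨fun C hC => hC.eq_empty_of_lt hp (by norm_num) (by omega) (by norm_num),
    fun C hC => hC.eq_empty_of_card_lt hp (by norm_num) (by omega) (by norm_num) (by norm_num)
      (by rw [hrank]; norm_num)⟩
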